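/- Let {s_n}_{n ≥ k} be a sequence of nonnegative integers such that (a) 2·s_n ≤ n − 3 for all n ≥ k, (b) s_n/n → 0 as n → ∞, and (c) 2^{s_n} ≥ n² for all n ≥ k. Let T_n = T_{n,s_n} and let G_n be obtained from T_n by adding the edge uv. Then Den(G_n) → 2/3 as n → ∞. -/

import Mathlib

open Filter Topology

noncomputable section

namespace SubtreePaper

/-- The set of subtrees of `G`: subgraphs of `G` that are (nonempty) trees. -/
def subtrees {V : Type*} (G : SimpleGraph V) : Set G.Subgraph :=
  {H | H.coe.IsTree}

/-- The number of subtrees of `G`. -/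
def numSubtrees {V : Type*} (G : SimpleGraph V) : ℕ := (subtrees G).ncard

/-- The mean subtree order of `G`. -/
def mu {V : Type*} (G : SimpleGraph V) : ℝ :=
  (∑ᶠ H ∈ subtrees G, (H.verts.ncard : ℝ)) / (numSubtrees G)

/-- The density of `G`. -/
def den {V : Type*} [Fintype V] (G : SimpleGraph V) : ℝ :=
  mu G / (Fintype.card V)

/-- The local mean subtree order of `G` at an edge `e`. -/
def muEdge {V : Type*} (G : SimpleGraph V) (e : Sym2 V) : ℝ :=
  (∑ᶠ H ∈ {H ∈ subtrees G | e ∈ H.edgeSet}, (H.verts.ncard : ℝ)) /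
    ({H ∈ subtrees G | e ∈ H.edgeSet}.ncard)

/-- The local mean subtree order of `G` at a vertex `u`. -/
def muVert {V : Type*} (G : SimpleGraph V) (u : V) : ℝ :=
  (∑ᶠ H ∈ {H ∈ subtrees G | u ∈ H.verts}, (H.verts.ncard : ℝ)) /
    ({H ∈ subtrees G | u ∈ H.verts}.ncard)

/-- The graph obtained from `G` by adding an edge between `u` and `v`. -/
def addEdge {V : Type*} (G : SimpleGraph V) (u v : V) : SimpleGraph V :=
  G ⊔ SimpleGraph.fromEdgeSet {s(u, v)}


/-- The tree `T_{n,s}`: a path on the vertices `Sum.inl 0, …, Sum.inl (n - 2s - 1)`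
(of order `n - 2s`), with the `s` leaves `Sum.inr (Sum.inl j)` attached to the
endvertex `Sum.inl 0`, and the `s` leaves `Sum.inr (Sum.inr j)` attached to the
endvertex `Sum.inl (n - 2s - 1)`. -/
def Tns (n s : ℕ) : SimpleGraph (Fin (n - 2 * s) ⊕ Fin s ⊕ Fin s) :=
  SimpleGraph.fromRel fun a b =>
    match a, b with
    | Sum.inl i, Sum.inl j => (i : ℕ) + 1 = (j : ℕ)
    | Sum.inl i, Sum.inr (Sum.inl _) => (i : ℕ) = 0
    | Sum.inl i, Sum.inr (Sum.inr _) => (i : ℕ) = n - 2 * s - 1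
    | _, _ => False

/-- The endvertex `u` of the path in `T_{n,s}`. -/
def pu (n s : ℕ) (h : 2 * s + 3 ≤ n) : Fin (n - 2 * s) ⊕ Fin s ⊕ Fin s :=
  Sum.inl ⟨0, by omega⟩

/-- The endvertex `v` of the path in `T_{n,s}`. -/
def pv (n s : ℕ) (h : 2 * s + 3 ≤ n) : Fin (n - 2 * s) ⊕ Fin s ⊕ Fin s :=
  Sum.inl ⟨n - 2 * s - 1, by omega⟩

/-- The graph `G_{n,s}`, obtained from `T_{n,s}` by adding the edge `uv`. -/
def Gns (n s : ℕ) (h : 2 * s + 3 ≤ n) :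
    SimpleGraph (Fin (n - 2 * s) ⊕ Fin s ⊕ Fin s) :=
  addEdge (Tns n s) (pu n s h) (pv n s h)

/-- The density of `G_{n,s}` (with junk value `0` when `2s > n - 3`). -/
def GnsDen (n s : ℕ) : ℝ :=
  if h : 2 * s + 3 ≤ n then den (Gns n s h) else 0

/-- The number of subtrees of `G_{n,s}` (with junk value `0` when `2s > n - 3`). -/
def GnsNum (n s : ℕ) : ℕ :=
  if h : 2 * s + 3 ≤ n then numSubtrees (Gns n s h) else 0

theorem connected_of_closure {V : Type*} {G : SimpleGraph V} {H : G.Subgraph} {x : V}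
    (hx : x ∈ H.verts)
    (h : ∀ S : Set V, x ∈ S → (∀ a b, H.Adj a b → a ∈ S → b ∈ S) → H.verts ⊆ S) :
    H.coe.Connected := by
  have key : H.verts ⊆ {y | ∃ hy : y ∈ H.verts, H.coe.Reachable ⟨x, hx⟩ ⟨y, hy⟩} := by
    refine h _ ⟨hx, SimpleGraph.Reachable.refl _⟩ ?_
    rintro a b hab ⟨ha, hr⟩
    exact ⟨hab.snd_mem, hr.trans (SimpleGraph.Adj.reachable (by simpa using hab))⟩
  refine (SimpleGraph.connected_iff_exists_forall_reachable _).2 ⟨⟨x, hx⟩, ?_⟩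
  rintro ⟨y, hy⟩
  exact (key hy).2

theorem verts_subset_of_connected {V : Type*} {G : SimpleGraph V} {H : G.Subgraph}
    (hH : H.coe.Connected) {x : V} (hx : x ∈ H.verts) {S : Set V} (hxS : x ∈ S)
    (hS : ∀ a b, H.Adj a b → a ∈ S → b ∈ S) : H.verts ⊆ S := by
  intro y hy
  obtain ⟨w⟩ := hH.preconnected ⟨x, hx⟩ ⟨y, hy⟩
  have : ∀ (a b : H.verts), H.coe.Walk a b → (a : V) ∈ S → (b : V) ∈ S := by
    intro a b w
    induction w with
    | nil => exact id
    | cons hab _ ih => exact fun ha => ih (hS _ _ (by simpa using hab) ha)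
  exact this _ _ w hxS

theorem exists_adj_of_connected {V : Type*} {G : SimpleGraph V} {H : G.Subgraph}
    (hH : H.coe.Connected) {x y : V} (hx : x ∈ H.verts) (hy : y ∈ H.verts) (hxy : x ≠ y) :
    ∃ z, H.Adj x z := by
  by_contra! hcon
  have := verts_subset_of_connected hH hx (S := {x}) rfl
    (fun a b hab ha => by
      rw [Set.mem_singleton_iff] at ha
      subst ha
      exact absurd hab (hcon b))
  exact hxy (this hy).symm

theorem isAcyclic_of_rank {V : Type*} {G : SimpleGraph V} (f : V → ℕ)
    (hf : ∀ a b c, G.Adj a b → G.Adj a c → f b ≤ f a → f c ≤ f a → b = c) :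
    G.IsAcyclic := by
  classical
  intro v w hw
  obtain ⟨a, ha, hmax⟩ := w.support.toFinset.exists_max_image f ⟨v, by simp⟩
  simp only [List.mem_toFinset] at ha hmax
  have hc := hw.rotate ha
  have hmem : ∀ b, b ∈ (w.rotate a ha).support → f b ≤ f a := fun b hb =>
    hmax b (by simpa using hb)
  have hn : ¬ (w.rotate a ha).Nil := hc.not_nil
  refine hc.snd_ne_penultimate (hf a _ _ ((w.rotate a ha).adj_snd hn)
    ((w.rotate a ha).adj_penultimate hn).symm (hmem _ ?_) (hmem _ ?_))
  · exact SimpleGraph.Walk.getVert_mem_support _ _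
  · exact SimpleGraph.Walk.getVert_mem_support _ _

theorem exists_cut_of_isAcyclic {V : Type*} {G : SimpleGraph V} {H : G.Subgraph}
    (hH : H.coe.IsAcyclic) {u v : V} (huv : H.Adj u v) :
    ∃ S : Set V, u ∈ S ∧ v ∉ S ∧
      ∀ a b, H.Adj a b → a ∈ S → s(a, b) ≠ s(u, v) → b ∈ S := by
  have hb := SimpleGraph.isAcyclic_iff_forall_adj_isBridge.1 hH
    (v := ⟨u, huv.fst_mem⟩) (w := ⟨v, huv.snd_mem⟩) (by simpa using huv)
  rw [SimpleGraph.isBridge_iff] at hb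
  refine ⟨{y | ∃ hy : y ∈ H.verts, (H.coe \ SimpleGraph.fromEdgeSet
    {s((⟨u, huv.fst_mem⟩ : H.verts), ⟨v, huv.snd_mem⟩)}).Reachable ⟨u, huv.fst_mem⟩ ⟨y, hy⟩},
    ⟨huv.fst_mem, SimpleGraph.Reachable.refl _⟩, ?_, ?_⟩
  · rintro ⟨_, hr⟩
    exact hb hr
  · rintro a b hab ⟨ha, hr⟩ hne
    refine ⟨hab.snd_mem, hr.trans (SimpleGraph.Adj.reachable ?_)⟩
    simp only [SimpleGraph.sdiff_adj, SimpleGraph.Subgraph.coe_adj,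
      SimpleGraph.fromEdgeSet_adj]
    refine ⟨hab, fun h => hne ?_⟩
    have := h.1
    simpa using this

/-- The cycle on `Fin M` with `s` leaves attached to each of the adjacent vertices `0`, `M - 1`. -/
def sunGraph (M s : ℕ) (hM : 3 ≤ M) : SimpleGraph (Fin M ⊕ Fin s ⊕ Fin s) where
  Adj a b := match a, b with
    | Sum.inl i, Sum.inl j => (i : ℕ) + 1 = j ∨ (j : ℕ) + 1 = i ∨
        ((i : ℕ) = 0 ∧ (j : ℕ) + 1 = M) ∨ ((j : ℕ) = 0 ∧ (i : ℕ) + 1 = M)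
    | Sum.inl i, Sum.inr (Sum.inl _) => (i : ℕ) = 0
    | Sum.inl i, Sum.inr (Sum.inr _) => (i : ℕ) + 1 = M
    | Sum.inr (Sum.inl _), Sum.inl i => (i : ℕ) = 0
    | Sum.inr (Sum.inr _), Sum.inl i => (i : ℕ) + 1 = M
    | _, _ => False
  symm := ⟨by
    rintro (i | i | i) (j | j | j) <;> simp <;> omega⟩
  loopless := ⟨by
    rintro (i | i | i) <;> simp <;> omega⟩

theorem Gns_eq_sunGraph (n s : ℕ) (h : 2 * s + 3 ≤ n) :
    Gns n s h = sunGraph (n - 2 * s) s (by omega) := by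
  ext a b
  rcases a with i | i | i <;> rcases b with j | j | j <;>
    simp [Gns, addEdge, Tns, sunGraph, pu, pv, Fin.ext_iff] <;> omega

/-- The pairs consisting of the `p`-th and the `q`-th vertex of the cycle. -/
def IsPair {M s : ℕ} (p q : ℕ) (a b : Fin M ⊕ Fin s ⊕ Fin s) : Prop :=
  match a, b with
  | Sum.inl i, Sum.inl j => (i : ℕ) = p ∧ (j : ℕ) = q
  | _, _ => False

/-- The subgraph of the sun graph with vertex set `S` and all possible edges
except the one joining the cycle vertices `p` and `q`. -/
def cutSubgraph {M s : ℕ} (hM : 3 ≤ M) (S : Set (Fin M ⊕ Fin s ⊕ Fin s)) (p q : ℕ) :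
    (sunGraph M s hM).Subgraph where
  verts := S
  Adj a b := (sunGraph M s hM).Adj a b ∧ a ∈ S ∧ b ∈ S ∧ ¬ IsPair p q a b ∧ ¬ IsPair p q b a
  adj_sub h := h.1
  edge_vert h := h.2.1
  symm := ⟨fun _ _ h => ⟨h.1.symm, h.2.2.1, h.2.1, h.2.2.2.2, h.2.2.2.1⟩⟩

/-- The vertices of the sun graph lying on the cycle at a position satisfying `P`,
or in the given sets of leaves. -/
def sunVerts {M s : ℕ} (P : ℕ → Prop) [DecidablePred P] (L R : Finset (Fin s)) :
    Finset (Fin M ⊕ Fin s ⊕ Fin s) :=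
  (Finset.univ.filter fun i : Fin M => P i).disjSum (L.disjSum R)

/-- The subtree containing the edge between `0` and `M - 1` whose cycle vertices are those outside
the interval `(i, k]`, with leaf sets `L` and `R`. -/
def arcTree {M s : ℕ} (hM : 3 ≤ M)
    (c : (Σ _ : ℕ, ℕ) × Finset (Fin s) × Finset (Fin s)) : (sunGraph M s hM).Subgraph :=
  cutSubgraph hM
    (sunVerts (fun t => t ≤ c.1.2 ∨ c.1.1 < t) c.2.1 c.2.2 : Finset (Fin M ⊕ Fin s ⊕ Fin s))
    c.1.2 (c.1.2 + 1)

/-- The parameters of the subtrees `arcTree`. -/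
def arcParams (M s : ℕ) : Finset ((Σ _ : ℕ, ℕ) × Finset (Fin s) × Finset (Fin s)) :=
  ((Finset.range (M - 1)).sigma fun k => Finset.range (k + 1)) ×ˢ Finset.univ

theorem arcTree_isTree {M s : ℕ} (hM : 3 ≤ M) {i k : ℕ} (hik : i ≤ k) (hk : k + 1 < M)
    (L R : Finset (Fin s)) : (arcTree hM (⟨k, i⟩, L, R)).coe.IsTree := by
  refine ⟨?_, ?_⟩
  · refine connected_of_closure (x := Sum.inl ⟨0, by omega⟩) (by simp [arcTree, cutSubgraph,
      sunVerts]) ?_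
    intro S h0 hS
    have h1 : ∀ t : ℕ, ∀ ht : t < M, t ≤ i → (Sum.inl ⟨t, ht⟩ : Fin M ⊕ Fin s ⊕ Fin s) ∈ S := by
      intro t
      induction t with
      | zero => exact fun _ _ => h0
      | succ t ih =>
        intro ht hti
        refine hS _ _ ?_ (ih (by omega) (by omega))
        simp [arcTree, cutSubgraph, sunVerts, sunGraph, IsPair]
        omega
    have h2 : ∀ t : ℕ, ∀ ht : M - 1 - t < M, k < M - 1 - t →
        (Sum.inl ⟨M - 1 - t, ht⟩ : Fin M ⊕ Fin s ⊕ Fin s) ∈ S := by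
      intro t
      induction t with
      | zero =>
        intro ht hti
        refine hS _ _ ?_ h0
        simp [arcTree, cutSubgraph, sunVerts, sunGraph, IsPair]
        omega
      | succ t ih =>
        intro ht hti
        refine hS _ _ ?_ (ih (by omega) (by omega))
        simp [arcTree, cutSubgraph, sunVerts, sunGraph, IsPair]
        omega
    have h3 : ∀ t : Fin M, k < t → (Sum.inl t : Fin M ⊕ Fin s ⊕ Fin s) ∈ S := by
      intro t ht
      have := h2 (M - 1 - t) (by omega) (by omega)
      convert this using 3
      omega
    rintro (x | x | x) hx
    · simp [arcTree, cutSubgraph, sunVerts] at hx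
      rcases hx with hx | hx
      · exact h1 x x.2 hx
      · exact h3 x hx
    · simp [arcTree, cutSubgraph, sunVerts] at hx
      refine hS _ _ ?_ h0
      simp [arcTree, cutSubgraph, sunVerts, sunGraph, IsPair, hx]
    · simp [arcTree, cutSubgraph, sunVerts] at hx
      refine hS _ _ ?_ (h3 ⟨M - 1, by omega⟩ (by simp; omega))
      simp [arcTree, cutSubgraph, sunVerts, sunGraph, IsPair, hx]
      omega
  · let f : Fin M ⊕ Fin s ⊕ Fin s → ℕ := fun a => match a with
      | Sum.inl t => if (t : ℕ) ≤ i then (t : ℕ) else M - t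
      | Sum.inr _ => M + 1
    let par : Fin M ⊕ Fin s ⊕ Fin s → ℕ := fun a => match a with
      | Sum.inl t => if (t : ℕ) ≤ i then t - 1 else if (t : ℕ) + 1 = M then 0 else t + 1
      | Sum.inr (Sum.inl _) => 0
      | Sum.inr (Sum.inr _) => M - 1
    have key : ∀ a b, (arcTree hM (⟨k, i⟩, L, R)).Adj a b → f b ≤ f a →
        ∃ t : Fin M, b = Sum.inl t ∧ (t : ℕ) = par a := by
      rintro (x | x | x) (y | y | y) <;>
        simp [arcTree, cutSubgraph, sunVerts, sunGraph, IsPair, f, par] <;>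
        (try split_ifs) <;> omega
    refine isAcyclic_of_rank (fun a => f a) ?_
    rintro ⟨a, ha⟩ ⟨b, hb⟩ ⟨c, hc⟩ hab hac hfb hfc
    obtain ⟨t, rfl, ht⟩ := key a b hab hfb
    obtain ⟨t', rfl, ht'⟩ := key a c hac hfc
    have : t = t' := Fin.ext (ht.trans ht'.symm)
    subst this
    rfl

theorem arcTree_adj_iff {M s : ℕ} (hM : 3 ≤ M) {i k : ℕ} (hik : i ≤ k)
    (L R : Finset (Fin s)) (t : ℕ) (ht : t + 1 < M) :
    (arcTree hM (⟨k, i⟩, L, R)).Adj (Sum.inl ⟨t, by omega⟩) (Sum.inl ⟨t + 1, ht⟩) ↔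
      t < i ∨ k < t := by
  simp [arcTree, cutSubgraph, sunVerts, sunGraph, IsPair]
  omega

theorem arcTree_injOn {M s : ℕ} (hM : 3 ≤ M) :
    Set.InjOn (arcTree (s := s) hM) (arcParams M s) := by
  rintro ⟨⟨k, i⟩, L, R⟩ hc ⟨⟨k', i'⟩, L', R'⟩ hc' h
  simp [arcParams] at hc hc'
  have hE : ∀ t, t + 1 < M → ((t < i ∨ k < t) ↔ (t < i' ∨ k' < t)) := by
    intro t ht
    rw [← arcTree_adj_iff hM (by omega) L R t ht, h,
      arcTree_adj_iff hM (by omega) L' R' t ht]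
  have e1 := hE i (by omega)
  have e2 := hE i' (by omega)
  have e3 := hE k (by omega)
  have e4 := hE k' (by omega)
  have hi : i = i' := by omega
  have hk : k = k' := by omega
  have hv := congrArg SimpleGraph.Subgraph.verts h
  simp only [arcTree, cutSubgraph, Finset.coe_inj, sunVerts] at hv
  have hL : L = L' := by
    ext x
    simpa using Finset.ext_iff.1 hv (Sum.inr (Sum.inl x))
  have hR : R = R' := by
    ext x
    simpa using Finset.ext_iff.1 hv (Sum.inr (Sum.inr x))
  subst hi hk hL hR
  rfl

theorem leaf_mem_left {M s : ℕ} {hM : 3 ≤ M} {H : (sunGraph M s hM).Subgraph}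
    (hH : H.coe.Connected) {l : Fin s} (hl : Sum.inr (Sum.inl l) ∈ H.verts)
    {y : Fin M ⊕ Fin s ⊕ Fin s} (hy : y ∈ H.verts) (hne : Sum.inr (Sum.inl l) ≠ y) :
    H.Adj (Sum.inr (Sum.inl l)) (Sum.inl ⟨0, by omega⟩) := by
  obtain ⟨z, hz⟩ := exists_adj_of_connected hH hl hy hne
  have hz' := hz.adj_sub
  rcases z with z | z | z <;> simp [sunGraph] at hz'
  convert hz using 3
  exact hz'.symm

theorem leaf_mem_right {M s : ℕ} {hM : 3 ≤ M} {H : (sunGraph M s hM).Subgraph}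
    (hH : H.coe.Connected) {l : Fin s} (hl : Sum.inr (Sum.inr l) ∈ H.verts)
    {y : Fin M ⊕ Fin s ⊕ Fin s} (hy : y ∈ H.verts) (hne : Sum.inr (Sum.inr l) ≠ y) :
    H.Adj (Sum.inr (Sum.inr l)) (Sum.inl ⟨M - 1, by omega⟩) := by
  obtain ⟨z, hz⟩ := exists_adj_of_connected hH hl hy hne
  have hz' := hz.adj_sub
  rcases z with z | z | z <;> simp [sunGraph] at hz'
  convert hz using 3
  omega

/-- The edge joining the two neighbouring cycle vertices carrying leaves belongs to `H`. -/
def HasHubEdge {M s : ℕ} {hM : 3 ≤ M} (H : (sunGraph M s hM).Subgraph) : Prop :=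
  H.Adj (Sum.inl ⟨0, by omega⟩) (Sum.inl ⟨M - 1, by omega⟩)

theorem hasHubEdge_iff_adj {M s : ℕ} {hM : 3 ≤ M} {H : (sunGraph M s hM).Subgraph}
    {x y : Fin M} (hx : (x : ℕ) = 0) (hy : (y : ℕ) + 1 = M) :
    HasHubEdge H ↔ H.Adj (Sum.inl x) (Sum.inl y) := by
  obtain ⟨x, hxM⟩ := x
  obtain ⟨y, hyM⟩ := y
  obtain rfl : x = 0 := hx
  obtain rfl : y = M - 1 := by dsimp only at hy; omega
  rfl

theorem exists_eq_arcTree {M s : ℕ} {hM : 3 ≤ M} {H : (sunGraph M s hM).Subgraph}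
    (hH : H.coe.IsTree) (hE : HasHubEdge H) : ∃ c ∈ arcParams M s, arcTree hM c = H := by
  classical
  have hconn : H.coe.Connected := hH.connected
  have h0 : Sum.inl ⟨0, by omega⟩ ∈ H.verts := hE.fst_mem
  have hl : Sum.inl ⟨M - 1, by omega⟩ ∈ H.verts := hE.snd_mem
  let E : ℕ → Prop := fun t => ∃ ht : t + 1 < M,
    H.Adj (Sum.inl ⟨t, by omega⟩) (Sum.inl ⟨t + 1, ht⟩)
  have hEx : ∃ t, t + 1 < M ∧ ¬ E t := by
    by_contra! hall
    obtain ⟨S, hu, hv, hS⟩ := exists_cut_of_isAcyclic hH.isAcyclic hE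
    have : ∀ t, ∀ ht : t < M, (Sum.inl ⟨t, ht⟩ : Fin M ⊕ Fin s ⊕ Fin s) ∈ S := by
      intro t
      induction t with
      | zero => exact fun _ => hu
      | succ t ih =>
        intro ht
        obtain ⟨_, hadj⟩ := hall t ht
        refine hS _ _ hadj (ih (by omega)) ?_
        simp
        omega
    exact hv (this _ _)
  obtain ⟨i, ⟨hiM, hi⟩, himin⟩ : ∃ i, (i + 1 < M ∧ ¬ E i) ∧ ∀ t < i, E t :=
    ⟨Nat.find hEx, Nat.find_spec hEx, fun t ht => by
      by_contra hc
      exact Nat.find_min hEx ht ⟨by have := (Nat.find_spec hEx).1; omega, hc⟩⟩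
  obtain ⟨k, hkM, hk, hkmax⟩ : ∃ k, k + 1 < M ∧ ¬ E k ∧ ∀ t, k < t → t + 1 < M → E t := by
    have hne : ((Finset.range (M - 1)).filter fun t => ¬ E t).Nonempty :=
      ⟨i, by simp [hi]; omega⟩
    have hmem := Finset.max'_mem _ hne
    simp only [Finset.mem_filter, Finset.mem_range] at hmem
    refine ⟨_, by omega, hmem.2, fun t ht htM => ?_⟩
    by_contra hc
    have := Finset.le_max' ((Finset.range (M - 1)).filter fun t => ¬ E t) t
      (by simp [hc]; omega)
    omega
  have hik : i ≤ k := by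
    by_contra! hc
    exact hk (himin k hc)
  have hlow : ∀ x : Fin M, (x : ℕ) ≤ i → Sum.inl x ∈ H.verts := by
    rintro ⟨x, hx⟩ hxi
    rcases Nat.eq_zero_or_pos x with rfl | hpos
    · exact h0
    · obtain ⟨_, hadj⟩ := himin (x - 1) (by simp at hxi; omega)
      convert hadj.snd_mem using 3
      omega
  have hhigh : ∀ x : Fin M, k < (x : ℕ) → Sum.inl x ∈ H.verts := by
    rintro ⟨x, hx⟩ hxi
    by_cases hxl : x + 1 = M
    · convert hl using 3
      omega
    · obtain ⟨_, hadj⟩ := hkmax x hxi (by omega)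
      exact hadj.fst_mem
  have hEadj : ∀ x y : Fin M, (x : ℕ) + 1 = y → (H.Adj (Sum.inl x) (Sum.inl y) ↔ E x) := by
    rintro ⟨x, hx⟩ ⟨y, hy⟩ rfl
    exact ⟨fun h => ⟨hy, h⟩, fun h => h.2⟩
  have hsub : H.verts ⊆ {a : Fin M ⊕ Fin s ⊕ Fin s | ∀ x : Fin M, a = Sum.inl x →
      (x : ℕ) ≤ i ∨ k < x} := by
    refine verts_subset_of_connected hconn h0 ?_ ?_
    · intro x hx
      left
      simp only [Sum.inl.injEq] at hx
      simp [← hx]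
    · rintro a b hab ha y rfl
      have hG := hab.adj_sub
      rcases a with x | x | x <;> simp [sunGraph] at hG
      · have hx := ha x rfl
        rcases hG with h | h | h | h
        · have := (hEadj x y h).1 hab
          have h1 : (x : ℕ) ≠ i := fun h => hi (h ▸ this)
          omega
        · have := (hEadj y x h).1 hab.symm
          have h1 : (y : ℕ) ≠ k := fun h => hk (h ▸ this)
          omega
        · omega
        · omega
      · omega
      · omega
  refine ⟨(⟨k, i⟩, Finset.univ.filter fun l => Sum.inr (Sum.inl l) ∈ H.verts,
    Finset.univ.filter fun l => Sum.inr (Sum.inr l) ∈ H.verts), ?_, ?_⟩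
  · simp [arcParams]
    omega
  have hverts : ∀ a, a ∈ (sunVerts (fun t => t ≤ i ∨ k < t)
      (Finset.univ.filter fun l => Sum.inr (Sum.inl l) ∈ H.verts)
      (Finset.univ.filter fun l => Sum.inr (Sum.inr l) ∈ H.verts) :
        Finset (Fin M ⊕ Fin s ⊕ Fin s)) ↔ a ∈ H.verts := by
    rintro (x | x | x)
    · simp only [sunVerts, Finset.inl_mem_disjSum, Finset.mem_filter, Finset.mem_univ, true_and]
      exact ⟨fun h => h.elim (hlow x) (hhigh x), fun h => hsub h x rfl⟩
    · simp [sunVerts]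
    · simp [sunVerts]
  have hpath : ∀ x y : Fin M, (x : ℕ) + 1 = y → Sum.inl x ∈ H.verts → Sum.inl y ∈ H.verts →
      (x : ℕ) ≠ i → H.Adj (Sum.inl x) (Sum.inl y) := by
    intro x y hxy hx hy hxi
    rw [hEadj x y hxy]
    have h1 := hsub hx x rfl
    have h2 := hsub hy y rfl
    rcases h1 with h1 | h1
    · exact himin _ (by omega)
    · exact hkmax _ h1 (by omega)
  refine SimpleGraph.Subgraph.ext ?_ ?_
  · ext a
    exact_mod_cast hverts a
  · ext a b
    simp only [arcTree, cutSubgraph, Finset.mem_coe, hverts]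
    constructor
    · rintro ⟨hG, ha, hb, hp, hq⟩
      rcases a with x | x | x <;> rcases b with y | y | y <;> simp [sunGraph, IsPair] at hG hp hq
      · rcases hG with h | h | h | h
        · exact hpath x y h ha hb (by omega)
        · exact (hpath y x h hb ha (by omega)).symm
        · exact (hasHubEdge_iff_adj h.1 h.2).1 hE
        · exact ((hasHubEdge_iff_adj h.1 h.2).1 hE).symm
      · convert (leaf_mem_left hconn hb ha (by simp)).symm using 3
      · convert (leaf_mem_right hconn hb ha (by simp)).symm using 3
        omega
      · convert (leaf_mem_left hconn ha hb (by simp)) using 3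
      · convert (leaf_mem_right hconn ha hb (by simp)) using 3
        omega
    · intro hab
      refine ⟨hab.adj_sub, hab.fst_mem, hab.snd_mem, ?_, ?_⟩
      · rcases a with x | x | x <;> rcases b with y | y | y <;> simp only [IsPair, not_false_eq_true]
        rintro ⟨hx, hy⟩
        exact hi (hx ▸ (hEadj x y (by omega)).1 hab)
      · rcases a with x | x | x <;> rcases b with y | y | y <;> simp only [IsPair, not_false_eq_true]
        rintro ⟨hx, hy⟩
        exact hi (hx ▸ (hEadj y x (by omega)).1 hab.symm)

theorem arcTree_hasHubEdge {M s : ℕ} (hM : 3 ≤ M) {i k : ℕ} (hk : k + 1 < M)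
    (L R : Finset (Fin s)) : HasHubEdge (arcTree hM (⟨k, i⟩, L, R)) := by
  simp [HasHubEdge, arcTree, cutSubgraph, sunVerts, sunGraph, IsPair]
  omega

theorem setOf_isTree_hasHubEdge {M s : ℕ} (hM : 3 ≤ M) :
    {H ∈ subtrees (sunGraph M s hM) | HasHubEdge H} = arcTree hM '' (arcParams M s) := by
  ext H
  constructor
  · rintro ⟨hH, hE⟩
    exact exists_eq_arcTree hH hE
  · rintro ⟨⟨⟨k, i⟩, L, R⟩, hc, rfl⟩
    simp [arcParams] at hc
    exact ⟨arcTree_isTree hM (by omega) (by omega) L R,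
      arcTree_hasHubEdge hM (by omega) L R⟩

/-- The subtree spanned by the cycle vertices in the interval `[a, b]` with leaf sets `L`, `R`. -/
def segTree {M s : ℕ} (hM : 3 ≤ M) (a b : Fin M) (L R : Finset (Fin s)) :
    (sunGraph M s hM).Subgraph :=
  cutSubgraph hM
    (sunVerts (fun t => (a : ℕ) ≤ t ∧ t ≤ b) L R : Finset (Fin M ⊕ Fin s ⊕ Fin s)) 0 (M - 1)

theorem same_side {M s : ℕ} {hM : 3 ≤ M} {H : (sunGraph M s hM).Subgraph}
    (hH : H.coe.Connected) (hE : ¬ HasHubEdge H) {t : ℕ}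
    (ht : ∀ x y : Fin M, (x : ℕ) = t → (y : ℕ) = t + 1 → ¬ H.Adj (Sum.inl x) (Sum.inl y))
    {p q : Fin M} (hp : Sum.inl p ∈ H.verts) (hq : Sum.inl q ∈ H.verts)
    (hpt : (p : ℕ) ≤ t) : (q : ℕ) ≤ t := by
  by_contra! htq
  have := verts_subset_of_connected hH hp
    (S := {a | match a with
      | Sum.inl x => (x : ℕ) ≤ t
      | Sum.inr (Sum.inl _) => True
      | Sum.inr (Sum.inr _) => False}) hpt (by
    intro a b hab ha
    have hG := hab.adj_sub
    rcases a with x | x | x <;> rcases b with y | y | y <;> simp [sunGraph] at hG ha ⊢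
    · rcases hG with h | h | h | h
      · by_contra! hc
        exact ht x y (by omega) (by omega) hab
      · omega
      · exact absurd ((hasHubEdge_iff_adj h.1 h.2).2 hab) hE
      · omega
    · omega
    · omega)
  have h := this hq
  simp at h
  omega

theorem eq_segTree_or_singleton {M s : ℕ} {hM : 3 ≤ M} {H : (sunGraph M s hM).Subgraph}
    (hconn : H.coe.Connected) (hE : ¬ HasHubEdge H) :
    (∃ x, H = cutSubgraph hM {Sum.inr x} 0 (M - 1)) ∨
    ∃ a b L R, H = segTree hM a b L R ∧ ((L = ∅ ∧ R = ∅) ∨ a = ⟨0, by omega⟩ ∨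
      b = ⟨M - 1, by omega⟩) := by
  classical
  by_cases hcore : ∃ x, Sum.inl x ∈ H.verts
  swap
  · left
    push Not at hcore
    obtain ⟨⟨x, hx⟩⟩ := hconn.nonempty
    rcases x with x | x
    · exact absurd hx (hcore x)
    have hverts : ∀ y ∈ H.verts, y = Sum.inr x := by
      intro y hy
      by_contra hne
      rcases x with x | x
      · exact hcore _ (leaf_mem_left hconn hx hy (Ne.symm hne)).snd_mem
      · exact hcore _ (leaf_mem_right hconn hx hy (Ne.symm hne)).snd_mem
    refine ⟨x, SimpleGraph.Subgraph.ext ?_ ?_⟩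
    · ext y
      simp only [cutSubgraph, Set.mem_singleton_iff]
      exact ⟨hverts y, fun h => h ▸ hx⟩
    · ext y z
      simp only [cutSubgraph, Set.mem_singleton_iff]
      constructor
      · intro h
        have h1 := hverts y h.fst_mem
        have h2 := hverts z h.snd_mem
        subst h1 h2
        exact absurd h.adj_sub ((sunGraph M s hM).loopless.irrefl _)
      · rintro ⟨h, rfl, rfl, -⟩
        exact absurd h ((sunGraph M s hM).loopless.irrefl _)
  right
  obtain ⟨x₀, hx₀⟩ := hcore
  have hne : (Finset.univ.filter fun x : Fin M => Sum.inl x ∈ H.verts).Nonempty :=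
    ⟨x₀, by simpa using hx₀⟩
  obtain ⟨a, ha, hmin⟩ := Finset.exists_min_image _ (fun x : Fin M => (x : ℕ)) hne
  obtain ⟨b, hb, hmax⟩ := Finset.exists_max_image _ (fun x : Fin M => (x : ℕ)) hne
  simp only [Finset.mem_filter, Finset.mem_univ, true_and] at ha hb hmin hmax
  have hL : ∀ l, Sum.inr (Sum.inl l) ∈ H.verts →
      H.Adj (Sum.inr (Sum.inl l)) (Sum.inl ⟨0, by omega⟩) :=
    fun l h => leaf_mem_left hconn h ha (by simp)
  have hR : ∀ l, Sum.inr (Sum.inr l) ∈ H.verts →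
      H.Adj (Sum.inr (Sum.inr l)) (Sum.inl ⟨M - 1, by omega⟩) :=
    fun l h => leaf_mem_right hconn h ha (by simp)
  have hint : ∀ x : Fin M, (a : ℕ) ≤ x → (x : ℕ) ≤ b → Sum.inl x ∈ H.verts := by
    intro x hax hxb
    by_contra hx
    have hxa : (a : ℕ) ≠ x := fun h => hx (Fin.ext h ▸ ha)
    have := same_side hconn hE (t := x - 1) (fun y z _ hz hyz => hx (by
      have : z = x := Fin.ext (by omega)
      exact this ▸ hyz.snd_mem)) ha hb (by omega)
    omega
  have hadj : ∀ x y : Fin M, (x : ℕ) + 1 = y → Sum.inl x ∈ H.verts → Sum.inl y ∈ H.verts →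
      H.Adj (Sum.inl x) (Sum.inl y) := by
    intro x y hxy hx hy
    by_contra hc
    have := same_side hconn hE (t := x) (fun x' y' hx' hy' => by
      rw [Fin.ext hx', show y' = y from Fin.ext (by omega)]
      exact hc) hx hy le_rfl
    omega
  refine ⟨a, b, Finset.univ.filter fun l => Sum.inr (Sum.inl l) ∈ H.verts,
    Finset.univ.filter fun l => Sum.inr (Sum.inr l) ∈ H.verts, ?_, ?_⟩
  · have hverts : ∀ c, c ∈ (sunVerts (fun t => (a : ℕ) ≤ t ∧ t ≤ b)
        (Finset.univ.filter fun l => Sum.inr (Sum.inl l) ∈ H.verts)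
        (Finset.univ.filter fun l => Sum.inr (Sum.inr l) ∈ H.verts) :
          Finset (Fin M ⊕ Fin s ⊕ Fin s)) ↔ c ∈ H.verts := by
      rintro (x | x | x)
      · simp only [sunVerts, Finset.inl_mem_disjSum, Finset.mem_filter, Finset.mem_univ, true_and]
        exact ⟨fun h => hint x h.1 h.2, fun h => ⟨hmin x h, hmax x h⟩⟩
      · simp [sunVerts]
      · simp [sunVerts]
    refine SimpleGraph.Subgraph.ext ?_ ?_
    · ext c
      exact_mod_cast (hverts c).symm
    · ext c d
      simp only [segTree, cutSubgraph, Finset.mem_coe, hverts]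
      constructor
      · intro hcd
        refine ⟨hcd.adj_sub, hcd.fst_mem, hcd.snd_mem, ?_, ?_⟩
        · rcases c with x | x | x <;> rcases d with y | y | y <;>
            simp only [IsPair, not_false_eq_true]
          rintro ⟨hx, hy⟩
          exact hE ((hasHubEdge_iff_adj hx (by omega)).2 hcd)
        · rcases c with x | x | x <;> rcases d with y | y | y <;>
            simp only [IsPair, not_false_eq_true]
          rintro ⟨hx, hy⟩
          exact hE ((hasHubEdge_iff_adj hx (by omega)).2 hcd.symm)
      · rintro ⟨hG, hc, hd, hp, hq⟩
        rcases c with x | x | x <;> rcases d with y | y | y <;>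
          simp [sunGraph, IsPair] at hG hp hq
        · rcases hG with h | h | h | h
          · exact hadj x y h hc hd
          · exact (hadj y x h hd hc).symm
          · omega
          · omega
        · convert (hL _ hd).symm using 3
        · convert (hR _ hd).symm using 3
          omega
        · convert hL _ hc using 3
        · convert hR _ hc using 3
          omega
  · by_cases h1 : a = ⟨0, by omega⟩
    · exact Or.inr (Or.inl h1)
    by_cases h2 : b = ⟨M - 1, by omega⟩
    · exact Or.inr (Or.inr h2)
    left
    simp only [Finset.filter_eq_empty_iff, Finset.mem_univ, forall_const]
    refine ⟨fun l hl => h1 (Fin.ext ?_), fun l hl => h2 (Fin.ext ?_)⟩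
    · have := hmin _ (hL l hl).snd_mem
      simpa using this
    · have := hmax _ (hR l hl).snd_mem
      dsimp only at this ⊢
      omega

theorem ncard_range_le {α β : Type*} [Fintype α] (f : α → β) :
    (Set.range f).ncard ≤ Fintype.card α := by
  rw [← Set.image_univ]
  refine (Set.ncard_image_le Set.finite_univ).trans ?_
  rw [Set.ncard_univ, Nat.card_eq_fintype_card]

theorem ncard_not_hasHubEdge_le {M s : ℕ} (hM : 3 ≤ M) :
    {H ∈ subtrees (sunGraph M s hM) | ¬ HasHubEdge H}.ncard ≤
      2 * s + M ^ 2 + 2 * (M * 4 ^ s) := by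
  classical
  let f₁ : Fin s ⊕ Fin s → (sunGraph M s hM).Subgraph :=
    fun x => cutSubgraph hM {Sum.inr x} 0 (M - 1)
  let f₂ : Fin M × Fin M → (sunGraph M s hM).Subgraph := fun p => segTree hM p.1 p.2 ∅ ∅
  let f₃ : Fin M × Finset (Fin s) × Finset (Fin s) → (sunGraph M s hM).Subgraph :=
    fun p => segTree hM ⟨0, by omega⟩ p.1 p.2.1 p.2.2
  let f₄ : Fin M × Finset (Fin s) × Finset (Fin s) → (sunGraph M s hM).Subgraph :=
    fun p => segTree hM p.1 ⟨M - 1, by omega⟩ p.2.1 p.2.2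
  have hsub : {H ∈ subtrees (sunGraph M s hM) | ¬ HasHubEdge H} ⊆
      Set.range f₁ ∪ Set.range f₂ ∪ (Set.range f₃ ∪ Set.range f₄) := by
    rintro H ⟨hH, hE⟩
    rcases eq_segTree_or_singleton hH.connected hE with
      ⟨x, rfl⟩ | ⟨a, b, L, R, rfl, ⟨rfl, rfl⟩ | rfl | rfl⟩
    · exact Or.inl (Or.inl ⟨x, rfl⟩)
    · exact Or.inl (Or.inr ⟨(a, b), rfl⟩)
    · exact Or.inr (Or.inl ⟨(b, L, R), rfl⟩)
    · exact Or.inr (Or.inr ⟨(a, L, R), rfl⟩)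
  refine (Set.ncard_le_ncard hsub (Set.toFinite _)).trans ((Set.ncard_union_le _ _).trans
    (add_le_add ((Set.ncard_union_le _ _).trans (add_le_add ?_ ?_))
      ((Set.ncard_union_le _ _).trans ?_)))
  · exact (ncard_range_le f₁).trans (by simp; omega)
  · exact (ncard_range_le f₂).trans (by simp [pow_two])
  · have h4 : M * (2 ^ s * 2 ^ s) = M * 4 ^ s := by rw [← mul_pow]; norm_num
    have h₃ := ncard_range_le f₃
    have h₄ := ncard_range_le f₄
    simp [h4] at h₃ h₄
    omega

theorem card_filter_le_or_lt {M i k : ℕ} (hik : i ≤ k) (hk : k + 1 < M) :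
    (Finset.univ.filter fun t : Fin M => (t : ℕ) ≤ i ∨ k < t).card = M - (k - i) := by
  rw [Finset.card_filter, Fin.sum_univ_eq_sum_range (fun t => if t ≤ i ∨ k < t then 1 else 0) M,
    ← Finset.card_filter]
  have : (Finset.range M).filter (fun t => t ≤ i ∨ k < t) =
      Finset.range (i + 1) ∪ Finset.Ico (k + 1) M := by
    ext t
    simp
    omega
  rw [this, Finset.card_union_of_disjoint]
  · simp
    omega
  · rw [Finset.disjoint_left]
    simp
    omega

theorem ncard_verts_arcTree {M s : ℕ} (hM : 3 ≤ M) {i k : ℕ} (hik : i ≤ k) (hk : k + 1 < M)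
    (L R : Finset (Fin s)) :
    ((arcTree hM (⟨k, i⟩, L, R)).verts.ncard : ℝ) = M + i - k + (L.card + R.card) := by
  have : (arcTree hM (⟨k, i⟩, L, R)).verts.ncard = M - (k - i) + (L.card + R.card) := by
    simp only [arcTree, cutSubgraph, Set.ncard_coe_finset, sunVerts, Finset.card_disjSum]
    rw [card_filter_le_or_lt hik hk]
  rw [this]
  push_cast [Nat.cast_sub (show k - i ≤ M by omega), Nat.cast_sub hik]
  ring

theorem sum_sigma_core_order (c : ℝ) (m : ℕ) :
    ∑ p ∈ (Finset.range m).sigma fun k => Finset.range (k + 1), (c + (p.2 : ℝ) - (p.1 : ℝ)) =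
      m * (m + 1) / 2 * c - m * (m + 1) * (m - 1) / 6 := by
  rw [Finset.sum_sigma]
  have inner : ∀ (d : ℝ) (k : ℕ), ∑ i ∈ Finset.range k, (d + (i : ℝ)) = k * d + k * (k - 1) / 2 := by
    intro d k
    induction k with
    | zero => simp
    | succ k ih =>
      rw [Finset.sum_range_succ, ih]
      push_cast
      ring
  have : ∀ k ∈ Finset.range m, ∑ i ∈ Finset.range (k + 1), (c + (i : ℝ) - (k : ℝ)) =
      (k + 1) * (c - k) + (k + 1) * k / 2 := by
    intro k _
    rw [Finset.sum_congr rfl fun (i : ℕ) _ => (sub_add_eq_add_sub c (k : ℝ) (i : ℝ)).symm, inner]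
    push_cast
    ring
  rw [Finset.sum_congr rfl this]
  clear this
  induction m with
  | zero => simp
  | succ m ih =>
    rw [Finset.sum_range_succ, ih]
    push_cast
    ring

theorem card_sigma_range (m : ℕ) :
    ((((Finset.range m).sigma fun k => Finset.range (k + 1)).card : ℕ) : ℝ) =
      m * (m + 1) / 2 := by
  rw [Finset.card_sigma]
  induction m with
  | zero => simp
  | succ m ih =>
    rw [Finset.sum_range_succ, Nat.cast_add, ih]
    push_cast [Finset.card_range]
    ring

theorem card_arcParams {M : ℕ} (hM : 3 ≤ M) (s : ℕ) :
    ((arcParams M s).card : ℝ) = M * (M - 1) / 2 * 4 ^ s := by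
  rw [arcParams, Finset.card_product, Nat.cast_mul, card_sigma_range]
  have h4 : (2 : ℝ) ^ s * 2 ^ s = 4 ^ s := by rw [← mul_pow]; norm_num
  simp [h4, Nat.cast_sub (show 1 ≤ M by omega)]
  ring

theorem sum_core_order {M : ℕ} (hM : 3 ≤ M) (s : ℕ) :
    ∑ c ∈ arcParams M s, ((M : ℝ) + c.1.2 - c.1.1) =
      (arcParams M s).card * (2 * (M + 1) / 3) := by
  rw [card_arcParams hM, arcParams, Finset.sum_product]
  have h4 : (2 : ℝ) ^ s * 2 ^ s = 4 ^ s := by rw [← mul_pow]; norm_num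
  simp only [Finset.sum_const, nsmul_eq_mul]
  rw [← Finset.mul_sum, sum_sigma_core_order]
  simp [h4, Nat.cast_sub (show 1 ≤ M by omega)]
  ring

theorem sum_arcTree_bounds {M : ℕ} (hM : 3 ≤ M) (s : ℕ) :
    (arcParams M s).card * (2 * (M + 1) / 3 : ℝ) ≤
        ∑ c ∈ arcParams M s, ((arcTree hM c).verts.ncard : ℝ) ∧
      ∑ c ∈ arcParams M s, ((arcTree hM c).verts.ncard : ℝ) ≤
        (arcParams M s).card * (2 * (M + 1) / 3 + 2 * s : ℝ) := by
  have hcard : ∀ c ∈ arcParams M s, ((arcTree hM c).verts.ncard : ℝ) =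
      ((M : ℝ) + c.1.2 - c.1.1) + (c.2.1.card + c.2.2.card) := by
    rintro ⟨⟨k, i⟩, L, R⟩ hc
    simp [arcParams] at hc
    exact ncard_verts_arcTree hM (by omega) (by omega) L R
  rw [Finset.sum_congr rfl hcard, Finset.sum_add_distrib, sum_core_order hM,
    mul_add _ (2 * ((M : ℝ) + 1) / 3)]
  constructor
  · exact le_add_of_nonneg_right (Finset.sum_nonneg fun c _ => by positivity)
  · gcongr
    rw [← nsmul_eq_mul]
    refine Finset.sum_le_card_nsmul _ _ _ fun c _ => ?_
    have h1 : c.2.1.card ≤ s := by simpa using Finset.card_le_univ c.2.1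
    have h2 : c.2.2.card ≤ s := by simpa using Finset.card_le_univ c.2.2
    have : c.2.1.card + c.2.2.card ≤ 2 * s := by omega
    exact_mod_cast this

theorem den_sunGraph_eq {M : ℕ} (hM : 3 ≤ M) (s : ℕ) :
    ∃ B SB : ℝ, 0 ≤ B ∧ B ≤ 2 * s + (M : ℝ) ^ 2 + 2 * (M * 4 ^ s) ∧ 0 ≤ SB ∧
      SB ≤ B * (M + 2 * s) ∧
      den (sunGraph M s hM) = (∑ c ∈ arcParams M s, ((arcTree hM c).verts.ncard : ℝ) + SB) /
        ((arcParams M s).card + B) / (M + 2 * s) := by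
  classical
  set B := {H ∈ subtrees (sunGraph M s hM) | ¬ HasHubEdge H} with hB
  have hsplit : subtrees (sunGraph M s hM) = arcTree hM '' (arcParams M s) ∪ B := by
    rw [← setOf_isTree_hasHubEdge hM]
    ext H
    simp only [hB, Set.mem_union, Set.mem_ofPred_eq]
    tauto
  have hdisj : Disjoint (arcTree hM '' (arcParams M s)) B := by
    rw [← setOf_isTree_hasHubEdge hM, Set.disjoint_left]
    exact fun H h h' => h'.2 h.2
  have hcardV : ∀ H : (sunGraph M s hM).Subgraph, (H.verts.ncard : ℝ) ≤ M + 2 * s := by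
    intro H
    have := Set.ncard_le_ncard (Set.subset_univ H.verts) (Set.toFinite _)
    rw [Set.ncard_univ, Nat.card_eq_fintype_card] at this
    simp at this
    have h : H.verts.ncard ≤ M + 2 * s := by omega
    exact_mod_cast h
  refine ⟨B.ncard, ∑ᶠ H ∈ B, (H.verts.ncard : ℝ), by positivity, ?_, ?_, ?_, ?_⟩
  · exact_mod_cast ncard_not_hasHubEdge_le hM
  · exact finsum_nonneg fun H => finsum_nonneg fun _ => by positivity
  · rw [finsum_mem_eq_finite_toFinset_sum _ (Set.toFinite B), Set.ncard_eq_toFinset_card B,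
      ← nsmul_eq_mul]
    exact Finset.sum_le_card_nsmul _ _ _ fun H _ => hcardV H
  · rw [den, mu, numSubtrees, hsplit, finsum_mem_union hdisj (Set.toFinite _) (Set.toFinite _),
      Set.ncard_union_eq hdisj (Set.toFinite _) (Set.toFinite _),
      finsum_mem_image (arcTree_injOn hM), finsum_mem_coe_finset,
      (arcTree_injOn hM).ncard_image, Set.ncard_coe_finset]
    congr 1
    · push_cast
      rfl
    · simp
      ring

theorem den_sunGraph_bounds {M : ℕ} (hM : 3 ≤ M) {s : ℕ} (hs : M ^ 2 ≤ 2 ^ s) :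
    2 * ((M : ℝ) + 1) / 3 / (M + 2 * s) / (1 + 8 / M) ≤ den (sunGraph M s hM) ∧
      den (sunGraph M s hM) ≤
        2 * ((M : ℝ) + 1) / 3 / (M + 2 * s) + 2 * s / (M + 2 * s) + 8 / M := by
  obtain ⟨B, SB, hB0, hB, hSB0, hSB, hden⟩ := den_sunGraph_eq hM s
  obtain ⟨hl, hu⟩ := sum_arcTree_bounds hM s
  set S := ∑ c ∈ arcParams M s, ((arcTree hM c).verts.ncard : ℝ)
  set A : ℝ := ((arcParams M s).card : ℝ)
  have hM' : (3 : ℝ) ≤ M := by exact_mod_cast hM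
  have hAeq : A = M * (M - 1) / 2 * 4 ^ s := card_arcParams hM s
  have hApos : 0 < A := by
    rw [hAeq]
    have : (0 : ℝ) < M - 1 := by linarith
    positivity
  have h4 : (2 * s + M ^ 2 : ℝ) ≤ 2 * 4 ^ s := by
    have h1 : s + 1 ≤ 2 ^ s := Nat.lt_two_pow_self
    have h2 : (4 : ℕ) ^ s = 2 ^ s * 2 ^ s := by rw [← mul_pow]; norm_num
    have : 2 * s + M ^ 2 ≤ 2 * 4 ^ s := by
      rw [h2]
      nlinarith
    exact_mod_cast this
  have hBA : B ≤ 8 / M * A := by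
    rw [hAeq, show 8 / (M : ℝ) * (M * (M - 1) / 2 * 4 ^ s) = 4 * (M - 1) * 4 ^ s by
      field_simp; ring]
    have : (0 : ℝ) < 4 ^ s := by positivity
    nlinarith
  have hN : (0 : ℝ) < M + 2 * s := by positivity
  rw [hden]
  constructor
  · rw [div_right_comm _ _ (1 + 8 / (M : ℝ))]
    refine div_le_div_of_nonneg_right ?_ hN.le
    rw [div_le_div_iff₀ (by positivity) (by positivity)]
    have h5 : (0 : ℝ) ≤ 2 * (M + 1) / 3 := by positivity
    have h6 : (0 : ℝ) ≤ 8 / M := by positivity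
    calc 2 * ((M : ℝ) + 1) / 3 * (A + B) ≤ 2 * ((M : ℝ) + 1) / 3 * (A + 8 / M * A) := by gcongr
      _ = A * (2 * (M + 1) / 3) * (1 + 8 / M) := by ring
      _ ≤ (S + SB) * (1 + 8 / M) := by
        gcongr
        linarith
  · rw [div_le_iff₀ hN, div_le_iff₀ (by positivity)]
    calc S + SB ≤ A * (2 * (M + 1) / 3 + 2 * s) + 8 / M * A * (M + 2 * s) := by
          refine add_le_add hu (hSB.trans ?_)
          gcongr
      _ = (2 * ((M : ℝ) + 1) / 3 / (M + 2 * s) + 2 * s / (M + 2 * s) + 8 / M) *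
          (M + 2 * s) * A := by
        field_simp
      _ ≤ _ := by
        refine mul_le_mul_of_nonneg_left (by linarith) (by positivity)

theorem GnsDen_bounds {n s : ℕ} (h : 2 * s + 3 ≤ n) (hs : n ^ 2 ≤ 2 ^ s) (h4 : 4 * s ≤ n) :
    2 / 3 * (1 - 2 * ((s : ℝ) / n) + 1 / n) / (1 + 16 / n) ≤ GnsDen n s ∧
      GnsDen n s ≤ 2 / 3 * (1 - 2 * ((s : ℝ) / n) + 1 / n) + 2 * ((s : ℝ) / n) + 16 / n := by
  have hM : 3 ≤ n - 2 * s := by omega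
  have hG : GnsDen n s = den (sunGraph (n - 2 * s) s hM) := by
    rw [GnsDen, dif_pos h, Gns_eq_sunGraph]
  obtain ⟨hl, hu⟩ := den_sunGraph_bounds hM (s := s)
    ((Nat.pow_le_pow_left (Nat.sub_le _ _) 2).trans hs)
  rw [← hG] at hl hu
  push_cast [Nat.cast_sub (show 2 * s ≤ n by omega)] at hl hu
  rw [show (n : ℝ) - 2 * s + 2 * s = n by ring] at hl hu
  have hn : (0 : ℝ) < n := by exact_mod_cast (show 0 < n by omega)
  have h4' : (4 * s : ℝ) ≤ n := by exact_mod_cast h4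
  have h16 : 8 / ((n : ℝ) - 2 * s) ≤ 16 / n := by
    rw [div_le_div_iff₀ (by linarith) hn]
    linarith
  have h8 : 0 ≤ 8 / ((n : ℝ) - 2 * s) := div_nonneg (by norm_num) (by linarith)
  have hmain : 2 * ((n : ℝ) - 2 * s + 1) / 3 / n = 2 / 3 * (1 - 2 * ((s : ℝ) / n) + 1 / n) := by
    field_simp
  rw [hmain] at hl hu
  have hnonneg : 0 ≤ 2 / 3 * (1 - 2 * ((s : ℝ) / n) + 1 / n) := by
    rw [← hmain]
    exact div_nonneg (div_nonneg (by linarith) (by norm_num)) hn.le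
  constructor
  · refine le_trans ?_ hl
    gcongr
  · have : 2 * (s : ℝ) / n = 2 * ((s : ℝ) / n) := by ring
    linarith

/-- If `2·s_n ≤ n - 3` for all `n ≥ k`, `s_n/n → 0`, and `2^{s_n} ≥ n²` for all
`n ≥ k`, then `Den(G_n) → 2/3` where `G_n` is `T_{n,s_n}` plus the edge `uv`. -/
theorem den_Gns_tendsto_two_thirds (k : ℕ) (sq : ℕ → ℕ)
    (ha : ∀ n, k ≤ n → 2 * sq n + 3 ≤ n)
    (hb : Tendsto (fun n : ℕ => (sq n : ℝ) / n) atTop (𝓝 0))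
    (hc : ∀ n, k ≤ n → n ^ 2 ≤ 2 ^ sq n) :
    Tendsto (fun n : ℕ => GnsDen n (sq n)) atTop (𝓝 (2 / 3)) := by
  have hinv : ∀ c : ℝ, Tendsto (fun n : ℕ => c / (n : ℝ)) atTop (𝓝 0) :=
    fun c => tendsto_const_div_atTop_nhds_zero_nat c
  have hmain : Tendsto (fun n : ℕ => 2 / 3 * (1 - 2 * ((sq n : ℝ) / n) + 1 / n)) atTop
      (𝓝 (2 / 3)) := by
    simpa using (((hb.const_mul 2).const_sub 1).add (hinv 1)).const_mul (2 / 3)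
  have hlow : Tendsto (fun n : ℕ => 2 / 3 * (1 - 2 * ((sq n : ℝ) / n) + 1 / n) / (1 + 16 / n))
      atTop (𝓝 (2 / 3)) := by
    have := hmain.div ((hinv 16).const_add 1) (by norm_num)
    rwa [add_zero, div_one] at this
  have hupp : Tendsto (fun n : ℕ => 2 / 3 * (1 - 2 * ((sq n : ℝ) / n) + 1 / n) +
      2 * ((sq n : ℝ) / n) + 16 / n) atTop (𝓝 (2 / 3)) := by
    simpa using (hmain.add (hb.const_mul 2)).add (hinv 16)
  have hbounds : ∀ᶠ n : ℕ in atTop,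
      2 / 3 * (1 - 2 * ((sq n : ℝ) / n) + 1 / n) / (1 + 16 / n) ≤ GnsDen n (sq n) ∧
      GnsDen n (sq n) ≤
        2 / 3 * (1 - 2 * ((sq n : ℝ) / n) + 1 / n) + 2 * ((sq n : ℝ) / n) + 16 / n := by
    filter_upwards [eventually_ge_atTop k, hb.eventually_lt_const (show (0 : ℝ) < 1 / 4 by norm_num)]
      with n hn hlt
    refine GnsDen_bounds (ha n hn) (hc n hn) ?_
    have hpos : (0 : ℝ) < n := by exact_mod_cast (show 0 < n by have := ha n hn; omega)
    rw [div_lt_div_iff₀ hpos (by norm_num)] at hlt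
    have : ((4 * sq n : ℕ) : ℝ) ≤ n := by push_cast; linarith
    exact_mod_cast this
  exact tendsto_of_tendsto_of_tendsto_of_le_of_le' hlow hupp
    (hbounds.mono fun _ h => h.1) (hbounds.mono fun _ h => h.2)

end SubtreePaper
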